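/- For all smooth vector fields X and Y on ℝ², the identity X(g^st(Y,Y/X)) − 2·g^st([X,Y],Y/X) = 2·div(X)·g^st(Y,Y/X) holds at every point of ℝ². -/

import Mathlib

open scoped RealInnerProductSpace

noncomputable section

/-- The simple 2-Riemannian metric `g^st` on `ℝ²` induced by the Euclidean inner
product. -/
def gst2 (u v w : EuclideanSpace ℝ (Fin 2)) : ℝ :=
  ⟪u, v⟫ * ⟪w, w⟫ - ⟪u, w⟫ * ⟪v, w⟫

/-- The action `X(f)(p) = Df_p(X(p))` of a vector field `X` on `ℝ²` on a function. -/
def vfApply (X : EuclideanSpace ℝ (Fin 2) → EuclideanSpace ℝ (Fin 2))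
    (f : EuclideanSpace ℝ (Fin 2) → ℝ) (p : EuclideanSpace ℝ (Fin 2)) : ℝ :=
  fderiv ℝ f p (X p)

/-- The Lie bracket `[X,Y](p) = DY_p(X(p)) − DX_p(Y(p))` of vector fields on `ℝ²`. -/
def lieB (X Y : EuclideanSpace ℝ (Fin 2) → EuclideanSpace ℝ (Fin 2))
    (p : EuclideanSpace ℝ (Fin 2)) : EuclideanSpace ℝ (Fin 2) :=
  fderiv ℝ Y p (X p) - fderiv ℝ X p (Y p)

/-- The divergence `div X = ∂X₁/∂x + ∂X₂/∂y` of a vector field on `ℝ²`. -/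
def divVF (X : EuclideanSpace ℝ (Fin 2) → EuclideanSpace ℝ (Fin 2))
    (p : EuclideanSpace ℝ (Fin 2)) : ℝ :=
  ∑ i : Fin 2, fderiv ℝ X p (EuclideanSpace.single i 1) i

/-- Euclidean inner product on the plane in coordinates. -/
theorem inner_eq_coords (u v : EuclideanSpace ℝ (Fin 2)) :
    ⟪u, v⟫ = u 0 * v 0 + u 1 * v 1 := by
  simp [PiLp.inner_apply, Fin.sum_univ_two, mul_comm]

/-- A linear map on the plane is determined by its values on the standard basis. -/
theorem clm_apply_coords (A : EuclideanSpace ℝ (Fin 2) →L[ℝ] EuclideanSpace ℝ (Fin 2))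
    (v : EuclideanSpace ℝ (Fin 2)) (i : Fin 2) :
    A v i = v 0 * A (EuclideanSpace.single 0 1) i + v 1 * A (EuclideanSpace.single 1 1) i := by
  have hv : v = v 0 • EuclideanSpace.single 0 (1 : ℝ) + v 1 • EuclideanSpace.single 1 (1 : ℝ) := by
    ext j
    fin_cases j <;> simp
  conv_lhs => rw [hv]
  simp

/-- Derivative of `q ↦ g^st(Y q, Y q / X q)` in a direction `v`. -/
theorem fderiv_gst2_self {X Y : EuclideanSpace ℝ (Fin 2) → EuclideanSpace ℝ (Fin 2)}
    {p : EuclideanSpace ℝ (Fin 2)} (hX : DifferentiableAt ℝ X p) (hY : DifferentiableAt ℝ Y p)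
    (v : EuclideanSpace ℝ (Fin 2)) :
    fderiv ℝ (fun q => gst2 (Y q) (Y q) (X q)) p v =
      2 * ⟪Y p, fderiv ℝ Y p v⟫ * ⟪X p, X p⟫ + 2 * ⟪Y p, Y p⟫ * ⟪X p, fderiv ℝ X p v⟫ -
        2 * ⟪Y p, X p⟫ * (⟪Y p, fderiv ℝ X p v⟫ + ⟪fderiv ℝ Y p v, X p⟫) := by
  have hYY := hY.hasFDerivAt.inner ℝ hY.hasFDerivAt
  have hXX := hX.hasFDerivAt.inner ℝ hX.hasFDerivAt
  have hYX := hY.hasFDerivAt.inner ℝ hX.hasFDerivAt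
  have h : HasFDerivAt (fun q => gst2 (Y q) (Y q) (X q)) _ p :=
    (hYY.mul hXX).sub (hYX.mul hYX)
  rw [h.fderiv]
  simp [fderivInnerCLM_apply, real_inner_comm]
  ring

/-- Lemma 16 of the paper: for all smooth vector fields `X`, `Y` on `ℝ²`,
`X(g^st(Y,Y/X)) − 2·g^st([X,Y],Y/X) = 2·div(X)·g^st(Y,Y/X)`. -/
theorem gst2_divergence_identity
    (X Y : EuclideanSpace ℝ (Fin 2) → EuclideanSpace ℝ (Fin 2))
    (hX : ContDiff ℝ (⊤ : ℕ∞) X) (hY : ContDiff ℝ (⊤ : ℕ∞) Y) :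
    ∀ p : EuclideanSpace ℝ (Fin 2),
      vfApply X (fun q => gst2 (Y q) (Y q) (X q)) p - 2 * gst2 (lieB X Y p) (Y p) (X p) =
        2 * divVF X p * gst2 (Y p) (Y p) (X p) := by
  intro p
  have hXp : DifferentiableAt ℝ X p := hX.differentiable (by simp) p
  have hYp : DifferentiableAt ℝ Y p := hY.differentiable (by simp) p
  rw [vfApply, fderiv_gst2_self hXp hYp]
  simp only [gst2, lieB, divVF, inner_eq_coords,
    Fin.sum_univ_two, PiLp.sub_apply]
  simp only [clm_apply_coords (fderiv ℝ X p) (X p),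
    clm_apply_coords (fderiv ℝ X p) (Y p)]
  ring
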